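/- arXiv:1607.02535 — 2 statements merged into one kernel-verified Lean document; each statement's English description precedes it below -/
import Mathlib

section
/- Let 𝒜 be a linear map from real D₁×D₂ matrices to ℝ^T satisfying (1−δ)·‖V‖_F² ≤ ‖𝒜(V)‖² for every matrix V with rank(V) ≤ 2R, where 0 ≤ δ < 1. Let e ∈ ℝ^T, let W★ be a matrix of rank at most R, and set y := 𝒜(W★) + e. If W is a matrix of rank at most R and C > 0 satisfies C²·‖e‖² ≤ ‖y − 𝒜(W)‖², then ‖W − W★‖_F² ≤ ((1 + 1/C)²/(1−δ))·‖y − 𝒜(W)‖². -/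
/-- Frobenius inner product on real matrices: `⟨A,B⟩ = ∑ᵢⱼ Aᵢⱼ Bᵢⱼ = trace(AᵀB)`. -/
noncomputable def frobInner {D₁ D₂ : ℕ} (A B : Matrix (Fin D₁) (Fin D₂) ℝ) : ℝ :=
  ∑ i, ∑ j, A i j * B i j

/-- Frobenius norm on real matrices. -/
noncomputable def frobNorm {D₁ D₂ : ℕ} (A : Matrix (Fin D₁) (Fin D₂) ℝ) : ℝ :=
  Real.sqrt (frobInner A A)

/-- Subadditivity of matrix rank, for differences. -/
theorem Matrix.rank_sub_le_rank_add_rank {m n K : Type*} [Finite m] [Fintype n] [Field K]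
    (A B : Matrix m n K) : (A - B).rank ≤ A.rank + B.rank := by
  have := Fintype.ofFinite m
  have hle : LinearMap.range (A - B).mulVecLin ≤
      LinearMap.range A.mulVecLin ⊔ LinearMap.range B.mulVecLin := by
    rintro _ ⟨v, rfl⟩
    rw [Matrix.mulVecLin_apply, Matrix.sub_mulVec]
    exact Submodule.sub_mem _
      (Submodule.mem_sup_left ⟨v, rfl⟩) (Submodule.mem_sup_right ⟨v, rfl⟩)
  exact (Submodule.finrank_mono hle).trans (Submodule.finrank_add_le_finrank_add_finrank _ _)

/-- Estimation-error bound under the lower RIP bound of order `2R`: if `y = 𝒜(W★) + e`,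
`rank W ≤ R`, and the loss is above the noise floor `C²‖e‖² ≤ ‖y − 𝒜(W)‖²`, then
`‖W − W★‖_F² ≤ ((1 + 1/C)²/(1−δ))·‖y − 𝒜(W)‖²`. -/
theorem estimation_error_bound {D₁ D₂ T R : ℕ} (δ : ℝ) (hδ0 : 0 ≤ δ) (hδ1 : δ < 1)
    (𝒜 : Matrix (Fin D₁) (Fin D₂) ℝ →ₗ[ℝ] EuclideanSpace ℝ (Fin T))
    (hRIP : ∀ V : Matrix (Fin D₁) (Fin D₂) ℝ, V.rank ≤ 2 * R →
      (1 - δ) * frobNorm V ^ 2 ≤ ‖𝒜 V‖ ^ 2)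
    (e : EuclideanSpace ℝ (Fin T))
    (Wstar : Matrix (Fin D₁) (Fin D₂) ℝ) (hWstar : Wstar.rank ≤ R)
    (y : EuclideanSpace ℝ (Fin T)) (hy : y = 𝒜 Wstar + e)
    (W : Matrix (Fin D₁) (Fin D₂) ℝ) (hW : W.rank ≤ R)
    (C : ℝ) (hC : 0 < C) (hnoise : C ^ 2 * ‖e‖ ^ 2 ≤ ‖y - 𝒜 W‖ ^ 2) :
    frobNorm (W - Wstar) ^ 2 ≤ ((1 + 1 / C) ^ 2 / (1 - δ)) * ‖y - 𝒜 W‖ ^ 2 := by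
  have hrank : (W - Wstar).rank ≤ 2 * R := by
    have := Matrix.rank_sub_le_rank_add_rank W Wstar
    omega
  have hδ : 0 < 1 - δ := sub_pos.mpr hδ1
  have he : ‖e‖ ≤ 1 / C * ‖y - 𝒜 W‖ := by
    rw [← mul_pow] at hnoise
    have := pow_le_pow_iff_left₀ (by positivity) (norm_nonneg _) two_ne_zero |>.mp hnoise
    rw [one_div_mul_eq_div, le_div_iff₀ hC]
    linarith
  have hdiff : 𝒜 (W - Wstar) = e - (y - 𝒜 W) := by
    rw [hy, map_sub]
    abel
  have hnorm : ‖𝒜 (W - Wstar)‖ ≤ (1 + 1 / C) * ‖y - 𝒜 W‖ := by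
    rw [hdiff]
    linarith [norm_sub_le e (y - 𝒜 W)]
  rw [div_mul_eq_mul_div, le_div_iff₀ hδ, mul_comm, ← mul_pow]
  exact (hRIP _ hrank).trans (pow_le_pow_left₀ (norm_nonneg _) hnorm 2)
end

section
/- Let H be a real inner product space, A : H → ℝ^N a linear map, y ∈ ℝ^N, S : ℝ^N → ℝ^K a linear map, and ε ∈ (0,1), and suppose (1−ε)·‖A(x) − y‖² ≤ ‖S(A(x) − y)‖² ≤ (1+ε)·‖A(x) − y‖² for every x ∈ H. If x̃ ∈ H satisfies ‖S(A(x̃)) − S(y)‖ ≤ ‖S(A(x)) − S(y)‖ for every x ∈ H, then ‖A(x̃) − y‖² ≤ ((1+ε)/(1−ε))·‖A(x) − y‖² for every x ∈ H. -/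
/-- Deterministic core of the sketched least-squares approximation guarantee: if `S` is a
`(1±ε)` ℓ₂-subspace embedding for the residuals `A(x) − y` and `x̃` minimizes the sketched
least-squares objective, then `x̃` is a `(1+ε)/(1−ε)`-approximate minimizer of the original
least-squares loss. -/
theorem sketched_least_squares_approximation {H : Type*}
    [NormedAddCommGroup H] [InnerProductSpace ℝ H] {N K : ℕ}
    (A : H →ₗ[ℝ] EuclideanSpace ℝ (Fin N)) (y : EuclideanSpace ℝ (Fin N))
    (S : EuclideanSpace ℝ (Fin N) →ₗ[ℝ] EuclideanSpace ℝ (Fin K))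
    (ε : ℝ) (hε0 : 0 < ε) (hε1 : ε < 1)
    (hembed : ∀ x : H,
      (1 - ε) * ‖A x - y‖ ^ 2 ≤ ‖S (A x - y)‖ ^ 2 ∧
        ‖S (A x - y)‖ ^ 2 ≤ (1 + ε) * ‖A x - y‖ ^ 2)
    (xt : H) (hopt : ∀ x : H, ‖S (A xt) - S y‖ ≤ ‖S (A x) - S y‖) :
    ∀ x : H, ‖A xt - y‖ ^ 2 ≤ ((1 + ε) / (1 - ε)) * ‖A x - y‖ ^ 2 := by
  intro x
  have hsketch : ‖S (A xt - y)‖ ^ 2 ≤ ‖S (A x - y)‖ ^ 2 := by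
    rw [map_sub, map_sub]
    gcongr
    exact hopt x
  rw [div_mul_eq_mul_div, le_div_iff₀' (sub_pos.mpr hε1)]
  exact (hembed xt).1.trans (hsketch.trans (hembed x).2)
end
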